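/- For every point (x,y) ∈ ℝ² with f_k(x,y) = 0 one has P_m(x,y) = −c_k B(x,y) λ_k(x,y) ∂f_k/∂y(x,y) and Q_m(x,y) = c_k B(x,y) λ_k(x,y) ∂f_k/∂x(x,y), where c_k = Λ + 1 if m_k = 1 and c_k = Λ if m_k ≥ 2; consequently the vector field X_m vanishes at no point of the circle C_k, and C_k is a periodic orbit of X_m. -/

import Mathlib

open MvPolynomial Function Set Filter Real
open scoped Classical

noncomputable section

/-- Bivariate real polynomials, representing components of planar polynomial vector fields. -/
abbrev Poly2 := MvPolynomial (Fin 2) ℝ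

/-- Evaluation of a bivariate polynomial at a point of the plane. -/
def pev (P : Poly2) (p : ℝ × ℝ) : ℝ := MvPolynomial.eval ![p.1, p.2] P

/-- The circle polynomial `f(x,y) = (x−a)² + (y−b)² − ρ²`. -/
def fpoly (c : ℝ × ℝ) (ρ : ℝ) : Poly2 :=
  (X 0 - MvPolynomial.C c.1) ^ 2 + (X 1 - MvPolynomial.C c.2) ^ 2 - MvPolynomial.C (ρ ^ 2)

/-- The divergence `∂P/∂x + ∂Q/∂y` of the vector field `X = P ∂ₓ + Q ∂ᵧ`. -/
def divPoly (P Q : Poly2) : Poly2 := pderiv 0 P + pderiv 1 Q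

/-- `γ : ℝ → ℝ²` is a (C¹) solution of the vector field `X = P ∂ₓ + Q ∂ᵧ`. -/
def IsSolution (P Q : Poly2) (γ : ℝ → ℝ × ℝ) : Prop :=
  ∀ t, HasDerivAt γ (pev P (γ t), pev Q (γ t)) t

/-- `S` is a periodic orbit of `X = P ∂ₓ + Q ∂ᵧ`: the image of a nonconstant periodic solution. -/
def IsPeriodicOrbit (P Q : Poly2) (S : Set (ℝ × ℝ)) : Prop :=
  ∃ γ : ℝ → ℝ × ℝ, ∃ T : ℝ, 0 < T ∧ IsSolution P Q γ ∧ Function.Periodic γ T ∧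
    (∃ t₀ t₁, γ t₀ ≠ γ t₁) ∧ Set.range γ = S

/-- `S` is a limit cycle: a periodic orbit with a neighborhood meeting no other periodic orbit. -/
def IsLimitCycle (P Q : Poly2) (S : Set (ℝ × ℝ)) : Prop :=
  IsPeriodicOrbit P Q S ∧
  ∃ U : Set (ℝ × ℝ), IsOpen U ∧ S ⊆ U ∧
    ∀ S', IsPeriodicOrbit P Q S' → S' ≠ S → Disjoint S' U

/-- `T` is the least positive period of `γ`. -/
def IsLeastPeriod (γ : ℝ → ℝ × ℝ) (T : ℝ) : Prop :=
  0 < T ∧ Function.Periodic γ T ∧ ∀ T', 0 < T' → Function.Periodic γ T' → T ≤ T'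

/-- The (limit) cycle `S` has least period `T`: it is parametrized by a solution of least
period `T`. -/
def HasLeastPeriodCycle (P Q : Poly2) (S : Set (ℝ × ℝ)) (T : ℝ) : Prop :=
  ∃ γ : ℝ → ℝ × ℝ, IsSolution P Q γ ∧ Set.range γ = S ∧ IsLeastPeriod γ T

/-- `V` is a (polynomial) inverse integrating factor of `X = P ∂ₓ + Q ∂ᵧ`:
`P ∂V/∂x + Q ∂V/∂y = V (∂P/∂x + ∂Q/∂y)`. -/
def IsInvFactor (P Q V : Poly2) : Prop :=
  P * pderiv 0 V + Q * pderiv 1 V = V * divPoly P Q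

/-- An embedded closed curve in the plane: a set homeomorphic to the circle. -/
def IsCycle (S : Set (ℝ × ℝ)) : Prop :=
  Nonempty (S ≃ₜ Metric.sphere (0 : ℝ × ℝ) 1)

/-- The compact region `D_C` bounded by a closed curve `C`: the curve together with the
points of the complement whose connected component in the complement is bounded. -/
def encDisk (S : Set (ℝ × ℝ)) : Set (ℝ × ℝ) :=
  S ∪ {p | p ∉ S ∧ Bornology.IsBounded (connectedComponentIn Sᶜ p)}

/-- `C_k` is a primary cycle of the configuration `Γ`: no other `C_j` is contained in `D_{C_k}`. -/
def PrimaryCycle {n : ℕ} (Γ : Fin n → Set (ℝ × ℝ)) (k : Fin n) : Prop :=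
  ∀ j, j ≠ k → ¬ Γ j ⊆ encDisk (Γ k)

/-- The limit cycle `S`, with enclosed region `D`, is stable in the interior for
`X = P ∂ₓ + Q ∂ᵧ`: every solution starting in the bounded region enclosed by `S`
sufficiently close to `S` converges to `S` as `t → +∞`. -/
def InteriorStable (P Q : Poly2) (S D : Set (ℝ × ℝ)) : Prop :=
  ∃ U : Set (ℝ × ℝ), IsOpen U ∧ S ⊆ U ∧
    ∀ γ : ℝ → ℝ × ℝ, IsSolution P Q γ → γ 0 ∈ (D \ S) ∩ U →
      Filter.Tendsto (fun t => Metric.infDist (γ t) S) Filter.atTop (nhds 0)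

/-- The limit cycle `S`, with enclosed region `D`, is unstable in the interior:
every solution starting in the bounded region enclosed by `S` sufficiently close to `S`
converges to `S` as `t → −∞`. -/
def InteriorUnstable (P Q : Poly2) (S D : Set (ℝ × ℝ)) : Prop :=
  ∃ U : Set (ℝ × ℝ), IsOpen U ∧ S ⊆ U ∧
    ∀ γ : ℝ → ℝ × ℝ, IsSolution P Q γ → γ 0 ∈ (D \ S) ∩ U →
      Filter.Tendsto (fun t => Metric.infDist (γ t) S) Filter.atBot (nhds 0)

/-- The polynomial `g(x,y) = (x−a)² + (y−b)²`. -/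
def gpoly (c : ℝ × ℝ) : Poly2 :=
  (X 0 - MvPolynomial.C c.1) ^ 2 + (X 1 - MvPolynomial.C c.2) ^ 2

variable {n : ℕ}

/-- `f_k(x,y) = (x−x_k)² + (y−y_k)² − r_k²`. -/
def fk (ctr : Fin n → ℝ × ℝ) (rad : Fin n → ℝ) (k : Fin n) : Poly2 :=
  fpoly (ctr k) (rad k)

/-- The circle `C_k = f_k⁻¹(0)`. -/
def Ccir (ctr : Fin n → ℝ × ℝ) (rad : Fin n → ℝ) (k : Fin n) : Set (ℝ × ℝ) :=
  {p : ℝ × ℝ | pev (fk ctr rad k) p = 0}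

/-- The closed disc `D_{C_k}` bounded by the circle `C_k`. -/
def Ddisc (ctr : Fin n → ℝ × ℝ) (rad : Fin n → ℝ) (k : Fin n) : Set (ℝ × ℝ) :=
  {p : ℝ × ℝ | (p.1 - (ctr k).1) ^ 2 + (p.2 - (ctr k).2) ^ 2 ≤ (rad k) ^ 2}

/-- `C_k` is primary: no other circle `C_j` is contained in `D_{C_k}`. -/
def Primary (ctr : Fin n → ℝ × ℝ) (rad : Fin n → ℝ) (k : Fin n) : Prop :=
  ∀ j, j ≠ k → ¬ Ccir ctr rad j ⊆ Ddisc ctr rad k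

/-- `A = ∏_{k=1}^n f_k`. -/
def Apoly (ctr : Fin n → ℝ × ℝ) (rad : Fin n → ℝ) : Poly2 := ∏ k, fk ctr rad k

/-- `B = ∏_{k=1}^r g_k` (product over the primary indices, i.e. those with `k < r`). -/
def Bpoly (r : ℕ) (ctr : Fin n → ℝ × ℝ) : Poly2 :=
  ∏ k ∈ Finset.univ.filter (fun k : Fin n => (k : ℕ) < r), gpoly (ctr k)

/-- `μ_k = ∏_{j≠k} f_j`. -/
def muk (ctr : Fin n → ℝ × ℝ) (rad : Fin n → ℝ) (k : Fin n) : Poly2 :=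
  ∏ j ∈ Finset.univ.erase k, fk ctr rad j

/-- `P_T = A(∂B/∂x − ∂B/∂y) − B Σ_k τ_k μ_k ∂f_k/∂y`. -/
def PT (r : ℕ) (ctr : Fin n → ℝ × ℝ) (rad τ : Fin n → ℝ) : Poly2 :=
  Apoly ctr rad * (pderiv 0 (Bpoly r ctr) - pderiv 1 (Bpoly r ctr)) -
    Bpoly r ctr * ∑ k, MvPolynomial.C (τ k) * muk ctr rad k * pderiv 1 (fk ctr rad k)

/-- `Q_T = A(∂B/∂x + ∂B/∂y) + B Σ_k τ_k μ_k ∂f_k/∂x`. -/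
def QT (r : ℕ) (ctr : Fin n → ℝ × ℝ) (rad τ : Fin n → ℝ) : Poly2 :=
  Apoly ctr rad * (pderiv 0 (Bpoly r ctr) + pderiv 1 (Bpoly r ctr)) +
    Bpoly r ctr * ∑ k, MvPolynomial.C (τ k) * muk ctr rad k * pderiv 0 (fk ctr rad k)

/-- `N_k`: the number of circles `C_j`, `j ≠ k`, whose bounded disc contains `C_k`. -/
def Nk (ctr : Fin n → ℝ × ℝ) (rad : Fin n → ℝ) (k : Fin n) : ℕ :=
  Nat.card {j : Fin n // j ≠ k ∧ Ccir ctr rad k ⊆ Ddisc ctr rad j}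

/-- `s_k`: the number of primary circles contained in the closed disc `D_{C_k}`. -/
def sk (r : ℕ) (ctr : Fin n → ℝ × ℝ) (rad : Fin n → ℝ) (k : Fin n) : ℕ :=
  Nat.card {j : Fin n // (j : ℕ) < r ∧ Ccir ctr rad j ⊆ Ddisc ctr rad k}

/-- `λ_k = ∏_{j≠k} f_j^{m_j}`. -/
def lamk (ctr : Fin n → ℝ × ℝ) (rad : Fin n → ℝ) (m : Fin n → ℕ) (k : Fin n) : Poly2 :=
  ∏ j ∈ Finset.univ.erase k, fk ctr rad j ^ m j

/-- `Λ = Σ_k (m_k − 1)`. -/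
def Lam (m : Fin n → ℕ) : ℕ := ∑ k, (m k - 1)

/-- `A_m = ∏_k f_k^{m_k}`. -/
def Am (ctr : Fin n → ℝ × ℝ) (rad : Fin n → ℝ) (m : Fin n → ℕ) : Poly2 :=
  ∏ k, fk ctr rad k ^ m k

/-- `P_{LR} = A(∂B/∂x − ∂B/∂y) − B Σ_k μ_k ∂f_k/∂y`. -/
def PLR (r : ℕ) (ctr : Fin n → ℝ × ℝ) (rad : Fin n → ℝ) : Poly2 :=
  Apoly ctr rad * (pderiv 0 (Bpoly r ctr) - pderiv 1 (Bpoly r ctr)) -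
    Bpoly r ctr * ∑ k, muk ctr rad k * pderiv 1 (fk ctr rad k)

/-- `Q_{LR} = A(∂B/∂x + ∂B/∂y) + B Σ_k μ_k ∂f_k/∂x`. -/
def QLR (r : ℕ) (ctr : Fin n → ℝ × ℝ) (rad : Fin n → ℝ) : Poly2 :=
  Apoly ctr rad * (pderiv 0 (Bpoly r ctr) + pderiv 1 (Bpoly r ctr)) +
    Bpoly r ctr * ∑ k, muk ctr rad k * pderiv 0 (fk ctr rad k)

/-- `F = Λ Σ_k λ_k ∂f_k/∂y`. -/
def Fm (ctr : Fin n → ℝ × ℝ) (rad : Fin n → ℝ) (m : Fin n → ℕ) : Poly2 :=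
  MvPolynomial.C ((Lam m : ℕ) : ℝ) * ∑ k, lamk ctr rad m k * pderiv 1 (fk ctr rad k)

/-- `G = Λ Σ_k λ_k ∂f_k/∂x`. -/
def Gm (ctr : Fin n → ℝ × ℝ) (rad : Fin n → ℝ) (m : Fin n → ℕ) : Poly2 :=
  MvPolynomial.C ((Lam m : ℕ) : ℝ) * ∑ k, lamk ctr rad m k * pderiv 0 (fk ctr rad k)

/-- `P_m = P_{LR} · ∏_k f_k^{m_k−1} − B F`. -/
def Pm (r : ℕ) (ctr : Fin n → ℝ × ℝ) (rad : Fin n → ℝ) (m : Fin n → ℕ) : Poly2 :=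
  PLR r ctr rad * ∏ k, fk ctr rad k ^ (m k - 1) - Bpoly r ctr * Fm ctr rad m

/-- `Q_m = Q_{LR} · ∏_k f_k^{m_k−1} + B G`. -/
def Qm (r : ℕ) (ctr : Fin n → ℝ × ℝ) (rad : Fin n → ℝ) (m : Fin n → ℕ) : Poly2 :=
  QLR r ctr rad * ∏ k, fk ctr rad k ^ (m k - 1) + Bpoly r ctr * Gm ctr rad m

/-- The autonomous equation `θ' = w θ` with `w` continuous, positive and `c`-periodic has a
surjective global solution advancing by `c` over a positive time `T`. -/
theorem exists_rotating_solution_of_pos {w : ℝ → ℝ} {c : ℝ} (hw : Continuous w) (hc : 0 < c)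
    (hper : Function.Periodic w c) (hpos : ∀ s, 0 < w s) :
    ∃ θ : ℝ → ℝ, ∃ T : ℝ, 0 < T ∧ (∀ t, HasDerivAt θ (w (θ t)) t) ∧ Function.Surjective θ ∧
      ∀ t, θ (t + T) = θ t + c := by
  have hu : Continuous fun s => (w s)⁻¹ := hw.inv₀ fun s => (hpos s).ne'
  have huper : Function.Periodic (fun s => (w s)⁻¹) c := fun s => by simp only [hper s]
  have hint : ∀ a b, IntervalIntegrable (fun s => (w s)⁻¹) MeasureTheory.volume a b :=
    fun a b => hu.intervalIntegrable a b
  have hder : ∀ s, HasDerivAt (fun s => ∫ x in (0 : ℝ)..s, (w x)⁻¹) (w s)⁻¹ s := fun s =>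
    intervalIntegral.integral_hasDerivAt_right (hint _ _)
      (hu.stronglyMeasurableAtFilter _ _) hu.continuousAt
  set τ : ℝ → ℝ := fun s => ∫ x in (0 : ℝ)..s, (w x)⁻¹ with hτ
  have hmono : StrictMono τ := strictMono_of_hasDerivAt_pos hder fun s => inv_pos.2 (hpos s)
  have h0 : τ 0 = 0 := by simp [hτ]
  have hTpos : 0 < τ c := by simpa [h0] using hmono hc
  have hcont : Continuous τ := continuous_iff_continuousAt.2 fun s => (hder s).continuousAt
  have hsurj : Function.Surjective τ :=
    hcont.surjective
      (huper.tendsto_atTop_intervalIntegral_of_pos hTpos hc)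
      (huper.tendsto_atBot_intervalIntegral_of_pos hTpos hc)
  have hadd : ∀ s, τ (s + c) = τ s + τ c := fun s => by
    have h1 := huper.intervalIntegral_add_eq s 0
    have h2 := intervalIntegral.integral_add_adjacent_intervals (hint 0 s) (hint s (s + c))
    simp only [zero_add] at h1
    simp only [hτ]
    rw [← h2, h1]
  let e := hmono.orderIsoOfSurjective τ hsurj
  have he : ∀ t, τ (e.symm t) = t := fun t => e.apply_symm_apply t
  refine ⟨e.symm, τ c, hTpos, fun t => ?_, e.symm.surjective, fun t => ?_⟩
  · have := (hder (e.symm t)).of_local_left_inverse e.symm.continuous.continuousAt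
      (inv_pos.2 (hpos _)).ne' (Eventually.of_forall he)
    simpa using this
  · apply hmono.injective
    rw [he, hadd, he]

/-- A continuous nowhere vanishing real function has constant sign. -/
theorem forall_pos_or_forall_neg_of_ne_zero {w : ℝ → ℝ} (hw : Continuous w) (h0 : ∀ s, w s ≠ 0) :
    (∀ s, 0 < w s) ∨ ∀ s, w s < 0 := by
  by_contra! h
  obtain ⟨⟨a, ha⟩, b, hb⟩ := h
  obtain ⟨s, hs⟩ := mem_range_of_exists_le_of_exists_ge hw ⟨a, ha⟩ ⟨b, hb⟩
  exact h0 s hs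

/-- The equation `θ' = w θ` with `w` continuous, nowhere zero and `c`-periodic has a
surjective global solution turning by `c` or by `-c` over a positive time `T`. -/
theorem exists_rotating_solution {w : ℝ → ℝ} {c : ℝ} (hw : Continuous w) (hc : 0 < c)
    (hper : Function.Periodic w c) (h0 : ∀ s, w s ≠ 0) :
    ∃ θ : ℝ → ℝ, ∃ T : ℝ, 0 < T ∧ (∀ t, HasDerivAt θ (w (θ t)) t) ∧ Function.Surjective θ ∧
      ((∀ t, θ (t + T) = θ t + c) ∨ ∀ t, θ (t + T) = θ t - c) := by
  rcases forall_pos_or_forall_neg_of_ne_zero hw h0 with hpos | hneg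
  · obtain ⟨θ, T, hT, hd, hs, hp⟩ := exists_rotating_solution_of_pos hw hc hper hpos
    exact ⟨θ, T, hT, hd, hs, Or.inl hp⟩
  · obtain ⟨θ, T, hT, hd, hs, hp⟩ := exists_rotating_solution_of_pos (w := fun s => -w s)
      hw.neg hc (fun s => by simp only [hper s]) fun s => neg_pos.2 (hneg s)
    refine ⟨fun t => θ (-t), T, hT, fun t => ?_, hs.comp neg_surjective, Or.inr fun t => ?_⟩
    · exact ((hd (-t)).scomp t (hasDerivAt_neg t)).congr_deriv (by simp)
    · have := hp (-(t + T))
      rw [show -(t + T) + T = -t by ring] at this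
      linarith

theorem continuous_pev (P : Poly2) : Continuous (pev P) :=
  (MvPolynomial.continuous_eval P).comp <| continuous_pi fun i => by
    fin_cases i
    · exact continuous_fst
    · exact continuous_snd

theorem pev_fk (ctr : Fin n → ℝ × ℝ) (rad : Fin n → ℝ) (k : Fin n) (p : ℝ × ℝ) :
    pev (fk ctr rad k) p = (p.1 - (ctr k).1) ^ 2 + (p.2 - (ctr k).2) ^ 2 - rad k ^ 2 := by
  simp [pev, fk, fpoly]

theorem pev_gpoly (c p : ℝ × ℝ) :
    pev (gpoly c) p = (p.1 - c.1) ^ 2 + (p.2 - c.2) ^ 2 := by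
  simp [pev, gpoly]

theorem pev_pderiv_zero_fk (ctr : Fin n → ℝ × ℝ) (rad : Fin n → ℝ) (k : Fin n) (p : ℝ × ℝ) :
    pev (pderiv 0 (fk ctr rad k)) p = 2 * (p.1 - (ctr k).1) := by
  simp [pev, fk, fpoly, pderiv_X, Derivation.leibniz_pow]

theorem pev_pderiv_one_fk (ctr : Fin n → ℝ × ℝ) (rad : Fin n → ℝ) (k : Fin n) (p : ℝ × ℝ) :
    pev (pderiv 1 (fk ctr rad k)) p = 2 * (p.2 - (ctr k).2) := by
  simp [pev, fk, fpoly, pderiv_X, Derivation.leibniz_pow]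

theorem pev_Bpoly_ne_zero (r : ℕ) {ctr : Fin n → ℝ × ℝ} {rad : Fin n → ℝ} {k : Fin n}
    (hctr : ∀ j, ctr j ∉ Ccir ctr rad k) {p : ℝ × ℝ} (hp : p ∈ Ccir ctr rad k) :
    pev (Bpoly r ctr) p ≠ 0 := by
  have hprod : pev (Bpoly r ctr) p =
      ∏ j ∈ Finset.univ.filter (fun j : Fin n => (j : ℕ) < r), pev (gpoly (ctr j)) p := by
    simp [pev, Bpoly, map_prod]
  rw [hprod, Finset.prod_ne_zero_iff]
  intro j _ hj
  rw [pev_gpoly] at hj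
  have h1 : p.1 - (ctr j).1 = 0 := by
    nlinarith [sq_nonneg (p.1 - (ctr j).1), sq_nonneg (p.2 - (ctr j).2)]
  have h2 : p.2 - (ctr j).2 = 0 := by
    nlinarith [sq_nonneg (p.1 - (ctr j).1), sq_nonneg (p.2 - (ctr j).2)]
  have hpj : p = ctr j := Prod.ext (sub_eq_zero.1 h1) (sub_eq_zero.1 h2)
  exact hctr j (hpj ▸ hp)

theorem pev_lamk_ne_zero {ctr : Fin n → ℝ × ℝ} {rad : Fin n → ℝ} (m : Fin n → ℕ) {k : Fin n}
    (hdisj : ∀ j, j ≠ k → Disjoint (Ccir ctr rad j) (Ccir ctr rad k)) {p : ℝ × ℝ}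
    (hp : p ∈ Ccir ctr rad k) : pev (lamk ctr rad m k) p ≠ 0 := by
  have hprod : pev (lamk ctr rad m k) p =
      ∏ j ∈ Finset.univ.erase k, pev (fk ctr rad j) p ^ m j := by
    simp [pev, lamk, map_prod]
  rw [hprod, Finset.prod_ne_zero_iff]
  exact fun j hj => pow_ne_zero _ fun h =>
    Set.disjoint_left.1 (hdisj j (Finset.ne_of_mem_erase hj)) h hp

/-- On `C_k` only the `k`-th summand of `Σ_j λ_j ∂f_j` survives. -/
theorem pev_sum_lamk_mul {ctr : Fin n → ℝ × ℝ} {rad : Fin n → ℝ} {m : Fin n → ℕ} {k : Fin n}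
    (hk : m k ≠ 0) (D : Fin n → Poly2) {p : ℝ × ℝ} (hp : pev (fk ctr rad k) p = 0) :
    pev (∑ j, lamk ctr rad m j * D j) p = pev (lamk ctr rad m k) p * pev (D k) p := by
  simp only [pev, map_sum, map_mul]
  refine Finset.sum_eq_single k (fun j _ hj => ?_) (by simp)
  have : MvPolynomial.eval ![p.1, p.2] (lamk ctr rad m j) = 0 := by
    rw [lamk, map_prod]
    refine Finset.prod_eq_zero (Finset.mem_erase.2 ⟨hj.symm, Finset.mem_univ k⟩) ?_
    rw [map_pow, show MvPolynomial.eval ![p.1, p.2] (fk ctr rad k) = 0 from hp, zero_pow hk]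
  rw [this, zero_mul]

theorem muk_eq_lamk_one (ctr : Fin n → ℝ × ℝ) (rad : Fin n → ℝ) (k : Fin n) :
    muk ctr rad k = lamk ctr rad (fun _ => 1) k := by
  simp [muk, lamk]

/-- On `C_k`, the factor `μ_k ∏_j f_j^{m_j−1}` is `λ_k` if `m_k = 1` and `0` otherwise. -/
theorem pev_muk_mul_prod {ctr : Fin n → ℝ × ℝ} {rad : Fin n → ℝ} {m : Fin n → ℕ}
    (hm : ∀ j, 1 ≤ m j) {k : Fin n} {p : ℝ × ℝ} (hp : pev (fk ctr rad k) p = 0) :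
    pev (muk ctr rad k) p * pev (∏ j, fk ctr rad j ^ (m j - 1)) p =
      if m k = 1 then pev (lamk ctr rad m k) p else 0 := by
  have hsplit : muk ctr rad k * ∏ j, fk ctr rad j ^ (m j - 1) =
      fk ctr rad k ^ (m k - 1) * lamk ctr rad m k := by
    rw [← Finset.mul_prod_erase _ _ (Finset.mem_univ k), mul_left_comm, muk, lamk,
      ← Finset.prod_mul_distrib]
    refine congrArg _ (Finset.prod_congr rfl fun j _ => ?_)
    rw [← pow_succ', Nat.sub_add_cancel (hm j)]
  have h : pev (muk ctr rad k) p * pev (∏ j, fk ctr rad j ^ (m j - 1)) p =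
      pev (fk ctr rad k) p ^ (m k - 1) * pev (lamk ctr rad m k) p := by
    simpa only [pev, map_mul, map_pow] using congrArg (MvPolynomial.eval ![p.1, p.2]) hsplit
  rw [h, hp]
  split_ifs with h1
  · simp [h1]
  · rw [zero_pow (by have := hm k; omega), zero_mul]

theorem pev_Apoly_eq_zero {ctr : Fin n → ℝ × ℝ} {rad : Fin n → ℝ} {k : Fin n} {p : ℝ × ℝ}
    (hp : pev (fk ctr rad k) p = 0) : pev (Apoly ctr rad) p = 0 := by
  rw [pev, Apoly, map_prod]
  exact Finset.prod_eq_zero (Finset.mem_univ k) hp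

/-- Values on `C_k` of the components of `X_m`. -/
theorem pev_Pm_Qm_of_mem {r : ℕ} {ctr : Fin n → ℝ × ℝ} {rad : Fin n → ℝ} {m : Fin n → ℕ}
    (hm : ∀ j, 1 ≤ m j) {k : Fin n} {p : ℝ × ℝ} (hp : pev (fk ctr rad k) p = 0) :
    pev (Pm r ctr rad m) p =
        -(if m k = 1 then ((Lam m : ℕ) : ℝ) + 1 else ((Lam m : ℕ) : ℝ)) *
          pev (Bpoly r ctr) p * pev (lamk ctr rad m k) p *
            pev (pderiv 1 (fk ctr rad k)) p ∧
      pev (Qm r ctr rad m) p =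
        (if m k = 1 then ((Lam m : ℕ) : ℝ) + 1 else ((Lam m : ℕ) : ℝ)) *
          pev (Bpoly r ctr) p * pev (lamk ctr rad m k) p *
            pev (pderiv 0 (fk ctr rad k)) p := by
  have hA := pev_Apoly_eq_zero hp
  have hprod := pev_muk_mul_prod hm hp
  have hlam := fun D => pev_sum_lamk_mul (Nat.one_le_iff_ne_zero.1 (hm k)) D hp
  have hmu := fun D => pev_sum_lamk_mul (m := fun _ => 1) one_ne_zero D hp
  simp only [← muk_eq_lamk_one] at hmu
  have hlam0 := hlam fun j => pderiv 0 (fk ctr rad j)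
  have hlam1 := hlam fun j => pderiv 1 (fk ctr rad j)
  have hmu0 := hmu fun j => pderiv 0 (fk ctr rad j)
  have hmu1 := hmu fun j => pderiv 1 (fk ctr rad j)
  have hif : (if m k = 1 then ((Lam m : ℕ) : ℝ) + 1 else ((Lam m : ℕ) : ℝ)) *
      pev (lamk ctr rad m k) p = Lam m * pev (lamk ctr rad m k) p +
        pev (muk ctr rad k) p * pev (∏ j, fk ctr rad j ^ (m j - 1)) p := by
    rw [hprod]
    split_ifs <;> ring
  have hP : pev (Pm r ctr rad m) p =
      (pev (Apoly ctr rad) p * pev (pderiv 0 (Bpoly r ctr) - pderiv 1 (Bpoly r ctr)) p -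
        pev (Bpoly r ctr) p * pev (∑ j, muk ctr rad j * pderiv 1 (fk ctr rad j)) p) *
          pev (∏ j, fk ctr rad j ^ (m j - 1)) p -
        pev (Bpoly r ctr) p *
          (Lam m * pev (∑ j, lamk ctr rad m j * pderiv 1 (fk ctr rad j)) p) := by
    simp only [pev, Pm, PLR, Fm, map_sub, map_mul, MvPolynomial.eval_C]
  have hQ : pev (Qm r ctr rad m) p =
      (pev (Apoly ctr rad) p * pev (pderiv 0 (Bpoly r ctr) + pderiv 1 (Bpoly r ctr)) p +
        pev (Bpoly r ctr) p * pev (∑ j, muk ctr rad j * pderiv 0 (fk ctr rad j)) p) *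
          pev (∏ j, fk ctr rad j ^ (m j - 1)) p +
        pev (Bpoly r ctr) p *
          (Lam m * pev (∑ j, lamk ctr rad m j * pderiv 0 (fk ctr rad j)) p) := by
    simp only [pev, Qm, QLR, Gm, map_add, map_mul, MvPolynomial.eval_C]
  constructor
  · rw [hP, hA, hmu1, hlam1]
    linear_combination pev (Bpoly r ctr) p * pev (pderiv 1 (fk ctr rad k)) p * hif
  · rw [hQ, hA, hmu0, hlam0]
    linear_combination -pev (Bpoly r ctr) p * pev (pderiv 0 (fk ctr rad k)) p * hif

theorem ite_Lam_ne_zero (m : Fin n → ℕ) (hm : ∀ j, 1 ≤ m j) (k : Fin n) :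
    (if m k = 1 then ((Lam m : ℕ) : ℝ) + 1 else ((Lam m : ℕ) : ℝ)) ≠ 0 := by
  split_ifs with h
  · positivity
  · have h1 : m k - 1 ≤ Lam m :=
      Finset.single_le_sum (f := fun j => m j - 1) (fun _ _ => Nat.zero_le _) (Finset.mem_univ k)
    have h2 := hm k
    exact Nat.cast_ne_zero.2 (by omega)

/-- The standard parametrization of the circle of center `c` and radius `ρ`. -/
def circleParam (c : ℝ × ℝ) (ρ s : ℝ) : ℝ × ℝ := (c.1 + ρ * Real.cos s, c.2 + ρ * Real.sin s)

theorem continuous_circleParam (c : ℝ × ℝ) (ρ : ℝ) : Continuous (circleParam c ρ) := by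
  unfold circleParam
  fun_prop

theorem periodic_circleParam (c : ℝ × ℝ) (ρ : ℝ) :
    Function.Periodic (circleParam c ρ) (2 * Real.pi) := fun s => by
  simp [circleParam]

theorem range_circleParam (ctr : Fin n → ℝ × ℝ) {rad : Fin n → ℝ} {k : Fin n}
    (hr : 0 < rad k) : Set.range (circleParam (ctr k) (rad k)) = Ccir ctr rad k := by
  ext p
  simp only [Set.mem_range, Ccir, Set.mem_ofPred_eq, pev_fk]
  constructor
  · rintro ⟨s, rfl⟩
    simp only [circleParam]
    linear_combination rad k ^ 2 * Real.sin_sq_add_cos_sq s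
  · intro h
    let z : ℂ := ⟨p.1 - (ctr k).1, p.2 - (ctr k).2⟩
    have hz : ‖z‖ = rad k := by
      rw [Complex.norm_eq_sqrt_sq_add_sq, Real.sqrt_eq_iff_mul_self_eq (by positivity) hr.le]
      simp only [z]
      linarith
    refine ⟨Complex.arg z, Prod.ext ?_ ?_⟩
    · simp [circleParam, ← hz, Complex.norm_mul_cos_arg, z]
    · simp [circleParam, ← hz, Complex.norm_mul_sin_arg, z]

/-- A circle along which the field is `h` times the rotation field, with `h` continuous and
nowhere zero on the circle, is a periodic orbit. -/
theorem isPeriodicOrbit_range_circleParam {P Q : Poly2} {c : ℝ × ℝ} {ρ : ℝ} (hρ : 0 < ρ)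
    {h : ℝ × ℝ → ℝ} (hcont : Continuous h) (h0 : ∀ s, h (circleParam c ρ s) ≠ 0)
    (hP : ∀ s, pev P (circleParam c ρ s) =
      -h (circleParam c ρ s) * ((circleParam c ρ s).2 - c.2))
    (hQ : ∀ s, pev Q (circleParam c ρ s) =
      h (circleParam c ρ s) * ((circleParam c ρ s).1 - c.1)) :
    IsPeriodicOrbit P Q (Set.range (circleParam c ρ)) := by
  obtain ⟨θ, T, hT, hd, hs, hp⟩ := exists_rotating_solution
    (w := fun s => h (circleParam c ρ s)) (hcont.comp (continuous_circleParam c ρ))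
    Real.two_pi_pos (fun s => by simp only [periodic_circleParam c ρ s]) h0
  refine ⟨circleParam c ρ ∘ θ, T, hT, fun t => ?_, fun t => ?_, ?_, hs.range_comp _⟩
  · have h1 := (((hd t).cos.const_mul ρ).const_add c.1)
    have h2 := (((hd t).sin.const_mul ρ).const_add c.2)
    refine (h1.prodMk h2).congr_deriv ?_
    simp only [Function.comp_apply, hP, hQ]
    refine Prod.ext ?_ ?_ <;> simp only [circleParam] <;> ring
  · rcases hp with hp | hp
    · simp only [Function.comp_apply, hp, periodic_circleParam c ρ (θ t)]
    · simp only [Function.comp_apply, hp, (periodic_circleParam c ρ).sub_eq (θ t)]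
  · obtain ⟨t₀, ht₀⟩ := hs 0
    obtain ⟨t₁, ht₁⟩ := hs Real.pi
    refine ⟨t₀, t₁, fun heq => ?_⟩
    have := congrArg Prod.fst heq
    simp only [Function.comp_apply, ht₀, ht₁, circleParam, Real.cos_zero, Real.cos_pi] at this
    linarith

/-- On the circle `{f_k = 0}` one has `P_m = −c_k B λ_k ∂f_k/∂y` and
`Q_m = c_k B λ_k ∂f_k/∂x`, where `c_k = Λ + 1` if `m_k = 1` and `c_k = Λ` if `m_k ≥ 2`;
consequently `X_m` vanishes at no point of `C_k`, and `C_k` is a periodic orbit of `X_m`. -/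
theorem Xm_on_circle
    (r : ℕ) (ctr : Fin n → ℝ × ℝ) (rad : Fin n → ℝ) (m : Fin n → ℕ)
    (hn : 1 ≤ n) (hrn : r ≤ n) (hrad : ∀ k, 0 < rad k)
    (hdisj : ∀ j k, j ≠ k → Disjoint (Ccir ctr rad j) (Ccir ctr rad k))
    (hctr : ∀ j k, ctr j ∉ Ccir ctr rad k)
    (hprim : ∀ k, Primary ctr rad k ↔ (k : ℕ) < r)
    (hm : ∀ k, 1 ≤ m k) (k : Fin n) :
    (∀ p : ℝ × ℝ, pev (fk ctr rad k) p = 0 →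
      pev (Pm r ctr rad m) p =
        -(if m k = 1 then ((Lam m : ℕ) : ℝ) + 1 else ((Lam m : ℕ) : ℝ)) *
          pev (Bpoly r ctr) p * pev (lamk ctr rad m k) p *
            pev (pderiv 1 (fk ctr rad k)) p ∧
      pev (Qm r ctr rad m) p =
        (if m k = 1 then ((Lam m : ℕ) : ℝ) + 1 else ((Lam m : ℕ) : ℝ)) *
          pev (Bpoly r ctr) p * pev (lamk ctr rad m k) p *
            pev (pderiv 0 (fk ctr rad k)) p) ∧
    (∀ p ∈ Ccir ctr rad k, (pev (Pm r ctr rad m) p, pev (Qm r ctr rad m) p) ≠ (0, 0)) ∧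
    IsPeriodicOrbit (Pm r ctr rad m) (Qm r ctr rad m) (Ccir ctr rad k) := by
  have hval : ∀ p : ℝ × ℝ, pev (fk ctr rad k) p = 0 → _ :=
    fun p hp => pev_Pm_Qm_of_mem (r := r) hm hp
  have hfac : ∀ p ∈ Ccir ctr rad k,
      (if m k = 1 then ((Lam m : ℕ) : ℝ) + 1 else ((Lam m : ℕ) : ℝ)) *
        pev (Bpoly r ctr) p * pev (lamk ctr rad m k) p ≠ 0 := fun p hp =>
    mul_ne_zero (mul_ne_zero (ite_Lam_ne_zero m hm k)
      (pev_Bpoly_ne_zero r (fun j => hctr j k) hp))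
      (pev_lamk_ne_zero m (fun j hj => hdisj j k hj) hp)
  refine ⟨hval, fun p hp h => ?_, ?_⟩
  · obtain ⟨hP, hQ⟩ := hval p hp
    rw [Prod.mk.injEq] at h
    rw [h.1, neg_mul, neg_mul, neg_mul, eq_comm, neg_eq_zero, mul_eq_zero,
      or_iff_right (hfac p hp), pev_pderiv_one_fk] at hP
    rw [h.2, eq_comm, mul_eq_zero, or_iff_right (hfac p hp), pev_pderiv_zero_fk] at hQ
    have hcirc : pev (fk ctr rad k) p = 0 := hp
    rw [pev_fk] at hcirc
    have := hrad k
    nlinarith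
  · have hmem : ∀ s, circleParam (ctr k) (rad k) s ∈ Ccir ctr rad k := fun s =>
      range_circleParam ctr (hrad k) ▸ Set.mem_range_self s
    rw [← range_circleParam ctr (hrad k)]
    refine isPeriodicOrbit_range_circleParam (hrad k)
      (h := fun p => 2 * ((if m k = 1 then ((Lam m : ℕ) : ℝ) + 1 else ((Lam m : ℕ) : ℝ)) *
        pev (Bpoly r ctr) p * pev (lamk ctr rad m k) p)) ?_ (fun s => ?_) (fun s => ?_)
        fun s => ?_
    · exact continuous_const.mul ((continuous_const.mul (continuous_pev _)).mul
        (continuous_pev _))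
    · exact mul_ne_zero two_ne_zero (hfac _ (hmem s))
    · rw [(hval _ (hmem s)).1, pev_pderiv_one_fk]
      ring
    · rw [(hval _ (hmem s)).2, pev_pderiv_zero_fk]
      ring
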